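/- arXiv:0712.1275 — 2 statements merged into one kernel-verified Lean document; each statement's English description precedes it below -/
import Mathlib

section
/- Almost surely, ω has no points of semi-strict increase and no points of semi-strict decrease; that is, the set of ω ∈ Ω possessing a point of semi-strict increase or decrease is null. -/
open Filter Topology MeasureTheory
open scoped ENNReal NNReal

namespace GTP

/-- The sample space `Ω`: all continuous functions `ω : [0,∞) → ℝ`. -/
def Omega : Type := {f : ℝ≥0 → ℝ // Continuous f}

/-- The filtration: `F t` is the smallest σ-algebra on `Ω` making all maps
`ω ↦ ω s`, `s ∈ [0,t]`, measurable. -/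
def F (t : ℝ≥0) : MeasurableSpace Omega :=
  ⨆ s : {s : ℝ≥0 // s ≤ t},
    MeasurableSpace.comap (fun ω : Omega => ω.1 s.1) inferInstance

/-- A stopping time relative to the filtration `(F t)`, with values in `[0,∞]`. -/
def IsStopping (τ : Omega → ℝ≥0∞) : Prop :=
  ∀ t : ℝ≥0, MeasurableSet[F t] {ω : Omega | τ ω ≤ (t : ℝ≥0∞)}

/-- `F_τ`-measurability of a function `h : Ω → ℝ`. -/
def MeasurableAtTime (τ : Omega → ℝ≥0∞) (h : Omega → ℝ) : Prop :=
  ∀ B : Set ℝ, MeasurableSet B → ∀ t : ℝ≥0,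
    MeasurableSet[F t] (h ⁻¹' B ∩ {ω : Omega | τ ω ≤ (t : ℝ≥0∞)})

/-- An elementary trading strategy: an increasing sequence of stopping times
`τ₁ ≤ τ₂ ≤ ⋯` tending to `∞`, together with bounded `F_{τ_n}`-measurable
portfolio functions `h_n`. -/
structure ElemStrategy where
  τ : ℕ → Omega → ℝ≥0∞
  stopping : ∀ n, IsStopping (τ n)
  mono : ∀ n ω, τ n ω ≤ τ (n + 1) ω
  tendsto_top : ∀ ω, Tendsto (fun n => τ n ω) atTop (𝓝 ⊤)
  h : ℕ → Omega → ℝ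
  h_bdd : ∀ n, ∃ C : ℝ, ∀ ω, |h n ω| ≤ C
  h_meas : ∀ n, MeasurableAtTime (τ n) (h n)

/-- The time `τ ∧ t` as an element of `[0,∞)`. -/
noncomputable def clip (τ : Omega → ℝ≥0∞) (t : ℝ≥0) (ω : Omega) : ℝ≥0 :=
  (min (τ ω) (t : ℝ≥0∞)).toNNReal

/-- The elementary capital process
`K_t(ω) := c + Σ_n h_n(ω) (ω(τ_{n+1} ∧ t) − ω(τ_n ∧ t))`. -/
noncomputable def elemCapital (G : ElemStrategy) (c : ℝ) (t : ℝ≥0) (ω : Omega) : ℝ :=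
  c + ∑' n : ℕ, G.h n ω * (ω.1 (clip (G.τ (n + 1)) t ω) - ω.1 (clip (G.τ n) t ω))

/-- A positive capital process: a countable sum of nonnegative elementary capital
processes with strictly positive summable initial capitals. -/
structure PosCapital where
  G : ℕ → ElemStrategy
  c : ℕ → ℝ
  c_pos : ∀ n, 0 < c n
  c_summable : Summable c
  nonneg : ∀ n t ω, 0 ≤ elemCapital (G n) (c n) t ω

/-- The value `S_t(ω) ∈ [0,∞]` of a positive capital process. -/
noncomputable def PosCapital.value (S : PosCapital) (t : ℝ≥0) (ω : Omega) : ℝ≥0∞ :=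
  ∑' n : ℕ, ENNReal.ofReal (elemCapital (S.G n) (S.c n) t ω)

/-- The initial value `S_0` of a positive capital process (independent of `ω`,
since `K^{G_n,c_n}_0 = c_n`). -/
noncomputable def PosCapital.init (S : PosCapital) : ℝ≥0∞ :=
  ∑' n : ℕ, ENNReal.ofReal (S.c n)

/-- Upper probability:
`UpProb(E) := inf { S₀ : S a positive capital process, liminf_{t→∞} S_t ≥ 1_E }`. -/
noncomputable def UpProb (E : Set Omega) : ℝ≥0∞ :=
  ⨅ (S : PosCapital) (_ : ∀ ω : Omega,
      E.indicator (fun _ => (1 : ℝ≥0∞)) ω ≤ liminf (fun t : ℝ≥0 => S.value t ω) atTop),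
    S.init

/-- A set is null if its upper probability is `0`. -/
def IsNull (E : Set Omega) : Prop := UpProb E = 0

/-- `t` is a point of semi-strict increase for `ω`: for some `δ > 0`,
`ω(s) ≤ ω(t) < ω(u)` for all `s ∈ ((t−δ)⁺, t)` and `u ∈ (t, t+δ)`. -/
def SemiStrictIncrease (ω : Omega) (t : ℝ≥0) : Prop :=
  ∃ δ : ℝ, 0 < δ ∧
    (∀ s : ℝ≥0, (t : ℝ) - δ < (s : ℝ) → s < t → ω.1 s ≤ ω.1 t) ∧
    (∀ u : ℝ≥0, t < u → (u : ℝ) < (t : ℝ) + δ → ω.1 t < ω.1 u)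

/-- `t` is a point of semi-strict decrease for `ω`. -/
def SemiStrictDecrease (ω : Omega) (t : ℝ≥0) : Prop :=
  ∃ δ : ℝ, 0 < δ ∧
    (∀ s : ℝ≥0, (t : ℝ) - δ < (s : ℝ) → s < t → ω.1 t ≤ ω.1 s) ∧
    (∀ u : ℝ≥0, t < u → (u : ℝ) < (t : ℝ) + δ → ω.1 u < ω.1 t)


/-! ### Pathwise hitting times -/

/-- First time `u ≥ s` with `0 ≤ z u`. -/
noncomputable def hitp (s : ℝ≥0∞) (z : ℝ≥0 → ℝ) : ℝ≥0∞ :=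
  ⨅ (u : ℝ≥0) (_ : s ≤ (u : ℝ≥0∞) ∧ 0 ≤ z u), (u : ℝ≥0∞)

lemma hitp_spec {s : ℝ≥0∞} {z : ℝ≥0 → ℝ} (hz : Continuous z) (h : hitp s z ≠ ⊤) :
    ∃ u : ℝ≥0, hitp s z = u ∧ s ≤ u ∧ 0 ≤ z u ∧ ∀ v : ℝ≥0, s ≤ v → 0 ≤ z v → u ≤ v := by
  set A : Set ℝ≥0 := {u | s ≤ (u : ℝ≥0∞) ∧ 0 ≤ z u} with hA
  have hcl : IsClosed A := by
    apply IsClosed.inter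
    · exact isClosed_le continuous_const ENNReal.continuous_coe
    · exact isClosed_le continuous_const hz
  have hne : A.Nonempty := by
    by_contra hne
    apply h
    rw [Set.not_nonempty_iff_eq_empty] at hne
    unfold hitp
    simp only [iInf_eq_top]
    intro u hu
    exact absurd (show u ∈ A from hu) (by simp [hne])
  have hm := hcl.csInf_mem hne (OrderBot.bddBelow A)
  have hle : ∀ v ∈ A, sInf A ≤ v := fun v hv => csInf_le (OrderBot.bddBelow A) hv
  refine ⟨sInf A, ?_, hm.1, hm.2, fun v h1 h2 => hle v ⟨h1, h2⟩⟩
  apply le_antisymm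
  · exact iInf₂_le (sInf A) hm
  · refine le_iInf₂ fun v hv => ?_
    exact_mod_cast hle v hv

lemma hitp_le {s : ℝ≥0∞} {z : ℝ≥0 → ℝ} {u : ℝ≥0} (h1 : s ≤ u) (h2 : 0 ≤ z u) :
    hitp s z ≤ u := iInf₂_le u ⟨h1, h2⟩

lemma le_hitp (s : ℝ≥0∞) (z : ℝ≥0 → ℝ) : s ≤ hitp s z := le_iInf₂ fun _ h => h.1

lemma hitp_le_iff {s : ℝ≥0∞} {z : ℝ≥0 → ℝ} (hz : Continuous z) (t : ℝ≥0) :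
    hitp s z ≤ t ↔ ∃ u ≤ t, s ≤ (u : ℝ≥0∞) ∧ 0 ≤ z u := by
  constructor
  · intro h
    obtain ⟨u, hu, h1, h2, _⟩ := hitp_spec hz (ne_top_of_le_ne_top ENNReal.coe_ne_top h)
    refine ⟨u, ?_, h1, h2⟩
    rw [hu] at h
    exact_mod_cast h
  · rintro ⟨u, hu, h1, h2⟩
    exact (hitp_le h1 h2).trans (by exact_mod_cast hu)

lemma hitp_zero {s u : ℝ≥0} {z : ℝ≥0 → ℝ} (hz : Continuous z) (hs : z s ≤ 0)
    (h : hitp s z = u) : z u = 0 := by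
  obtain ⟨u', hu, h1, h2, h3⟩ := hitp_spec hz (by rw [h]; exact ENNReal.coe_ne_top)
  have : u' = u := by rw [h] at hu; exact_mod_cast hu.symm
  subst this
  have h1' : s ≤ u' := by exact_mod_cast h1
  obtain ⟨v, hv, hv0⟩ := intermediate_value_Icc h1' hz.continuousOn (show (0:ℝ) ∈ _ from ⟨hs, h2⟩)
  have := h3 v (by exact_mod_cast hv.1) hv0.ge
  rw [le_antisymm this hv.2, hv0]

lemma hitp_le_congr {s : ℝ≥0∞} {z z' : ℝ≥0 → ℝ} (hz : Continuous z)
    {t : ℝ≥0} (h : ∀ u ≤ t, z u = z' u) (ht : hitp s z ≤ t) : hitp s z' ≤ hitp s z := by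
  obtain ⟨u, hu, h1, h2, _⟩ := hitp_spec hz (ne_top_of_le_ne_top ENNReal.coe_ne_top ht)
  rw [hu] at ht ⊢
  exact hitp_le h1 (by rw [← h u (by exact_mod_cast ht)]; exact h2)

lemma hitp_congr {s : ℝ≥0∞} {z z' : ℝ≥0 → ℝ} (hz : Continuous z) (hz' : Continuous z')
    {t : ℝ≥0} (h : ∀ u ≤ t, z u = z' u) (ht : hitp s z ≤ t) : hitp s z' = hitp s z := by
  have h1 := hitp_le_congr hz h ht
  exact le_antisymm h1 (hitp_le_congr hz' (fun u hu => (h u hu).symm) (h1.trans ht))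

/-! ### The pathwise strategy -/

/-- first time after `a` at which the path climbs to level `n` -/
noncomputable def sig (a : ℝ≥0) (y : ℝ≥0 → ℝ) : ℕ → ℝ≥0∞
  | 0 => a
  | n + 1 => hitp (sig a y n) (fun u => y u - (n + 1))

/-- starting level of the stage in progress when level `n` is first reached -/
noncomputable def stg (a : ℝ≥0) (y : ℝ≥0 → ℝ) : ℕ → ℕ
  | 0 => 0
  | n + 1 => if hitp (sig a y n) (fun u => ((stg a y n : ℝ) - 1) - y u) ≤ sig a y (n + 1)
      then n + 1 else stg a y n

/-- time of death of the stage -/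
noncomputable def dth (a : ℝ≥0) (y : ℝ≥0 → ℝ) (n : ℕ) : ℝ≥0∞ :=
  hitp (sig a y n) (fun u => ((stg a y n : ℝ) - 1) - y u)

noncomputable def rho (a : ℝ≥0) (y : ℝ≥0 → ℝ) (n : ℕ) : ℝ≥0∞ :=
  min (dth a y n) (sig a y (n + 1))

lemma stg_succ (a : ℝ≥0) (y : ℝ≥0 → ℝ) (n : ℕ) :
    stg a y (n + 1) = if dth a y n ≤ sig a y (n + 1) then n + 1 else stg a y n := rfl

lemma sig_succ (a : ℝ≥0) (y : ℝ≥0 → ℝ) (n : ℕ) :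
    sig a y (n + 1) = hitp (sig a y n) (fun u => y u - (n + 1)) := rfl

lemma sig_le_succ (a : ℝ≥0) (y : ℝ≥0 → ℝ) (n : ℕ) : sig a y n ≤ sig a y (n + 1) := le_hitp _ _
lemma sig_le_rho (a : ℝ≥0) (y : ℝ≥0 → ℝ) (n : ℕ) : sig a y n ≤ rho a y n :=
  le_min (le_hitp _ _) (le_hitp _ _)
lemma rho_le_sig (a : ℝ≥0) (y : ℝ≥0 → ℝ) (n : ℕ) : rho a y n ≤ sig a y (n + 1) := min_le_right _ _

lemma a_le_sig (a : ℝ≥0) (y : ℝ≥0 → ℝ) (n : ℕ) : (a : ℝ≥0∞) ≤ sig a y n := by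
  induction n with
  | zero => exact le_rfl
  | succ n ih => exact ih.trans (sig_le_succ a y n)

lemma stg_le (a : ℝ≥0) (y : ℝ≥0 → ℝ) (n : ℕ) : stg a y n ≤ n := by
  induction n with
  | zero => exact le_rfl
  | succ n ih =>
    rw [stg_succ]
    split_ifs
    · exact le_rfl
    · omega

lemma y_sig {a : ℝ≥0} {y : ℝ≥0 → ℝ} (hy : Continuous y) (ha : y a = 0) (n : ℕ) {s : ℝ≥0}
    (hs : sig a y n = s) : y s = n := by
  induction n generalizing s with
  | zero =>
    have : a = s := by
      have h : (a : ℝ≥0∞) = s := hs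
      exact_mod_cast h
    subst this
    simpa using ha
  | succ n ih =>
    have hne : sig a y n ≠ ⊤ :=
      ne_top_of_le_ne_top ENNReal.coe_ne_top ((sig_le_succ a y n).trans hs.le)
    obtain ⟨s', hs'⟩ := WithTop.ne_top_iff_exists.1 hne
    have h1 := ih hs'.symm
    rw [sig_succ, ← hs'] at hs
    have := hitp_zero (z := fun u => y u - (n + 1)) (by fun_prop) (by simp [h1]) hs
    push_cast
    linarith

lemma y_dth {a : ℝ≥0} {y : ℝ≥0 → ℝ} (hy : Continuous y) (ha : y a = 0) (n : ℕ) {s : ℝ≥0}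
    (hs : dth a y n = s) : y s = (stg a y n : ℝ) - 1 := by
  have hne : sig a y n ≠ ⊤ :=
    ne_top_of_le_ne_top ENNReal.coe_ne_top ((le_hitp _ _ : _ ≤ dth a y n).trans hs.le)
  obtain ⟨s', hs'⟩ := WithTop.ne_top_iff_exists.1 hne
  have h1 := y_sig hy ha n hs'.symm
  unfold dth at hs
  rw [← hs'] at hs
  have h2 : (stg a y n : ℝ) ≤ n := by exact_mod_cast stg_le a y n
  have := hitp_zero (z := fun u => ((stg a y n : ℝ) - 1) - y u) (by fun_prop)
    (by simp only [h1]; linarith) hs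
  linarith

/-- before death (inclusive), the path is above the death level -/
lemma y_ge {a : ℝ≥0} {y : ℝ≥0 → ℝ} (hy : Continuous y) (ha : y a = 0) (n : ℕ) {u : ℝ≥0}
    (h1 : sig a y n ≤ u) (h2 : (u : ℝ≥0∞) ≤ dth a y n) : (stg a y n : ℝ) - 1 ≤ y u := by
  by_contra hlt
  push Not at hlt
  have h3 : dth a y n ≤ u := hitp_le h1 (by linarith)
  have := y_dth hy ha n (le_antisymm h3 h2)
  linarith

lemma sig_stg_congr {a : ℝ≥0} {y y' : ℝ≥0 → ℝ} (hy : Continuous y) (hy' : Continuous y')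
    {t : ℝ≥0} (h : ∀ u ≤ t, y u = y' u) (n : ℕ) (hn : sig a y n ≤ t) :
    sig a y' n = sig a y n ∧ stg a y' n = stg a y n := by
  induction n with
  | zero => exact ⟨rfl, rfl⟩
  | succ n ih =>
    obtain ⟨h1, h2⟩ := ih ((sig_le_succ a y n).trans hn)
    have h3 : sig a y' (n + 1) = sig a y (n + 1) := by
      rw [sig_succ, sig_succ, h1]
      refine hitp_congr (t := t) (by fun_prop) (by fun_prop) ?_ ?_
      · intro u hu; simp only [h u hu]
      · exact hn
    refine ⟨h3, ?_⟩
    rw [stg_succ, stg_succ, h3, h2]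
    have : dth a y' n ≤ sig a y (n + 1) ↔ dth a y n ≤ sig a y (n + 1) := by
      unfold dth
      rw [h1, h2]
      constructor
      · intro h4
        exact (hitp_le_congr (t := t) (by fun_prop) (fun u hu => by simp only [h u hu])
          (h4.trans hn)).trans h4
      · intro h4
        exact (hitp_le_congr (t := t) (by fun_prop) (fun u hu => by simp only [h u hu])
          (h4.trans hn)).trans h4
    simp only [this]

lemma rho_congr {a : ℝ≥0} {y y' : ℝ≥0 → ℝ} (hy : Continuous y) (hy' : Continuous y')
    {t : ℝ≥0} (h : ∀ u ≤ t, y u = y' u) (n : ℕ) (hn : rho a y n ≤ t) : rho a y' n ≤ t := by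
  obtain ⟨h1, h2⟩ := sig_stg_congr hy hy' h n ((sig_le_rho a y n).trans hn)
  unfold rho at hn ⊢
  rw [min_le_iff] at hn ⊢
  rcases hn with hn | hn
  · left
    unfold dth at hn ⊢
    rw [h1, h2]
    exact (hitp_le_congr (t := t) (by fun_prop) (fun u hu => by simp only [h u hu]) hn).trans hn
  · right
    rw [(sig_stg_congr hy hy' h (n + 1) hn).1]
    exact hn

/-! ### Capital -/

noncomputable def cl (τ : ℝ≥0∞) (t : ℝ≥0) : ℝ≥0 := (min τ (t : ℝ≥0∞)).toNNReal

lemma cl_of_ge {τ : ℝ≥0∞} {t : ℝ≥0} (h : (t : ℝ≥0∞) ≤ τ) : cl τ t = t := by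
  simp [cl, min_eq_right h]

lemma cl_of_le {τ : ℝ≥0∞} {t : ℝ≥0} (h : τ ≤ t) : (cl τ t : ℝ≥0∞) = τ := by
  rw [cl, min_eq_left h, ENNReal.coe_toNNReal (ne_top_of_le_ne_top ENNReal.coe_ne_top h)]

lemma coe_cl (τ : ℝ≥0∞) (t : ℝ≥0) : (cl τ t : ℝ≥0∞) = min τ t := by
  rw [cl, ENNReal.coe_toNNReal (ne_top_of_le_ne_top ENNReal.coe_ne_top (min_le_right _ _))]

noncomputable def Hs (n : ℕ) : ℝ := ∑ i ∈ Finset.range n, 1 / ((i : ℝ) + 1)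

lemma Hs_succ (n : ℕ) : Hs (n + 1) = Hs n + 1 / ((n : ℝ) + 1) := Finset.sum_range_succ _ _

lemma Hs_nonneg (n : ℕ) : 0 ≤ Hs n := Finset.sum_nonneg fun i _ => by positivity

lemma Hs_mono : Monotone Hs := monotone_nat_of_le_succ fun n => by
  rw [Hs_succ]
  have : 0 ≤ 1 / ((n : ℝ) + 1) := by positivity
  linarith

noncomputable def KK (a : ℝ≥0) (y : ℝ≥0 → ℝ) (lam : ℝ) (N n : ℕ) (t : ℝ≥0) : ℝ :=
  lam * N + ∑ i ∈ Finset.range n,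
    lam * Hs (i - stg a y i + 1) * (y (cl (rho a y i) t) - y (cl (sig a y i) t))

lemma KK_succ (a : ℝ≥0) (y : ℝ≥0 → ℝ) (lam : ℝ) (N n : ℕ) (t : ℝ≥0) :
    KK a y lam N (n + 1) t = KK a y lam N n t +
    lam * Hs (n - stg a y n + 1) * (y (cl (rho a y n) t) - y (cl (sig a y n) t)) := by
  unfold KK
  rw [Finset.sum_range_succ, add_assoc]

lemma KK_eq {a : ℝ≥0} {y : ℝ≥0 → ℝ} (hy : Continuous y) (ha : y a = 0) (lam : ℝ) (N n : ℕ)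
    {t : ℝ≥0} (hn : sig a y n ≤ t) : KK a y lam N n t =
      lam * ((N : ℝ) - n) + lam * ((n : ℝ) - stg a y n + 1) * Hs (n - stg a y n) := by
  induction n with
  | zero => simp [KK, stg, Hs]
  | succ n ih =>
    have hn' := (sig_le_succ a y n).trans hn
    have hsn := y_sig hy ha n (cl_of_le hn').symm
    have hle := stg_le a y n
    have hc : ((n - stg a y n : ℕ) : ℝ) = (n : ℝ) - stg a y n := by
      push_cast [hle]; ring
    have hpos : (n : ℝ) - stg a y n + 1 ≠ 0 := by
      rw [← hc]; positivity
    rw [KK_succ, ih hn', hsn, stg_succ, Hs_succ, hc]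
    split_ifs with hd
    · have hr : rho a y n = dth a y n := min_eq_left hd
      have := y_dth hy ha n (cl_of_le (hd.trans hn)).symm
      rw [hr, this]
      simp only [Nat.sub_self]
      simp only [Hs, Finset.range_zero, Finset.sum_empty]
      field_simp
      push_cast
      ring
    · have hr : rho a y n = sig a y (n + 1) := min_eq_right (le_of_not_ge hd)
      have := y_sig hy ha (n + 1) (cl_of_le hn).symm
      rw [hr, this]
      have e : n + 1 - stg a y n = (n - stg a y n) + 1 := by omega
      rw [e, Hs_succ, hc]
      push_cast
      field_simp
      ring

lemma KK_nonneg {a : ℝ≥0} {y : ℝ≥0 → ℝ} (hy : Continuous y) (ha : y a = 0) {lam : ℝ}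
    (hlam : 0 ≤ lam) (N n : ℕ) (hnN : n ≤ N) (t : ℝ≥0) : 0 ≤ KK a y lam N n t := by
  have hA : ∀ n ≤ N, sig a y n ≤ t → 0 ≤ KK a y lam N n t := by
    intro n hnN hs
    rw [KK_eq hy ha lam N n hs]
    have h1 : (n : ℝ) ≤ N := by exact_mod_cast hnN
    have h2 : (stg a y n : ℝ) ≤ n := by exact_mod_cast stg_le a y n
    have h3 := Hs_nonneg (n - stg a y n)
    have h4 : 0 ≤ lam * ((N : ℝ) - n) := mul_nonneg hlam (by linarith)
    have h5 : 0 ≤ lam * ((n : ℝ) - stg a y n + 1) * Hs (n - stg a y n) :=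
      mul_nonneg (mul_nonneg hlam (by linarith)) h3
    linarith
  induction n with
  | zero => simp [KK]; positivity
  | succ n ih =>
    by_cases h1 : sig a y (n + 1) ≤ t
    · exact hA _ hnN h1
    push Not at h1
    by_cases h2 : sig a y n ≤ t
    · rw [KK_succ, KK_eq hy ha lam N n h2, y_sig hy ha n (cl_of_le h2).symm]
      have hge : (stg a y n : ℝ) - 1 ≤ y (cl (rho a y n) t) := by
        apply y_ge hy ha n
        · rw [coe_cl]; exact le_min (sig_le_rho a y n) h2
        · rw [coe_cl]; exact (min_le_left _ _).trans (min_le_left _ _)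
      have hle := stg_le a y n
      have hc : ((n - stg a y n : ℕ) : ℝ) = (n : ℝ) - stg a y n := by
        push_cast [hle]; ring
      have hpos : (n : ℝ) - stg a y n + 1 ≠ 0 := by
        rw [← hc]; positivity
      have h3 : lam * Hs (n - stg a y n + 1) * ((stg a y n : ℝ) - 1 - n) ≤
          lam * Hs (n - stg a y n + 1) * (y (cl (rho a y n) t) - n) :=
        mul_le_mul_of_nonneg_left (by linarith) (mul_nonneg hlam (Hs_nonneg _))
      have h4 : lam * ((N : ℝ) - n) + lam * ((n : ℝ) - stg a y n + 1) * Hs (n - stg a y n) +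
          lam * Hs (n - stg a y n + 1) * ((stg a y n : ℝ) - 1 - n) = lam * ((N : ℝ) - (n + 1)) := by
        rw [Hs_succ, hc]
        field_simp
        ring
      have h5 : 0 ≤ lam * ((N : ℝ) - (n + 1)) := by
        have : ((n : ℝ) + 1) ≤ N := by exact_mod_cast hnN
        exact mul_nonneg hlam (by linarith)
      linarith
    · push Not at h2
      rw [KK_succ, cl_of_ge h2.le, cl_of_ge (h2.le.trans (sig_le_rho a y n))]
      simpa using ih (by omega)

lemma KK_final {a : ℝ≥0} {y : ℝ≥0 → ℝ} (hy : Continuous y) (ha : y a = 0) {lam : ℝ}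
    (hlam : 0 ≤ lam) (p : ℕ) {t b : ℝ≥0} (hat : a ≤ t) (hmax : ∀ s, a ≤ s → s ≤ t → y s ≤ y t)
    (hp : y t < p) (hb : ((2 * p : ℕ) : ℝ) ≤ y b) (htb : t < b)
    (hmin : ∀ u, t < u → u ≤ b → y t < y u) {T : ℝ≥0} (hT : b ≤ T) :
    lam * p * Hs p ≤ KK a y lam (2 * p) (2 * p) T := by
  have hsb : ∀ n ≤ 2 * p, sig a y n ≤ b := by
    intro n
    induction n with
    | zero =>
      intro _
      change (a : ℝ≥0∞) ≤ b
      exact_mod_cast hat.trans htb.le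
    | succ n ih =>
      intro hn
      refine hitp_le (ih (by omega)) ?_
      have : ((n + 1 : ℕ) : ℝ) ≤ ((2 * p : ℕ) : ℝ) := by exact_mod_cast hn
      push_cast at this hb
      linarith
  have hyt : 0 ≤ y t := by rw [← ha]; exact hmax a le_rfl hat
  set k := ⌊y t⌋₊ with hk
  have hk1 : (k : ℝ) ≤ y t := Nat.floor_le hyt
  have hk2 : y t < k + 1 := Nat.lt_floor_add_one _
  have hkp : k + 1 ≤ p := by
    have : k < p := (Nat.floor_lt hyt).2 hp
    omega
  have hts : (t : ℝ≥0∞) < sig a y (k + 1) := by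
    by_contra hcon
    push Not at hcon
    have h1 := cl_of_le hcon
    have h2 := y_sig hy ha (k + 1) h1.symm
    have h3 := hmax (cl (sig a y (k + 1)) t) (by exact_mod_cast h1 ▸ a_le_sig a y (k + 1))
      (by rw [← ENNReal.coe_le_coe, h1]; exact hcon)
    rw [h2] at h3
    push_cast at h3
    linarith
  have hst : ∀ n, k + 1 ≤ n → n ≤ 2 * p → stg a y n ≤ k + 1 ∧ (t : ℝ≥0∞) < sig a y n := by
    intro n hn
    induction n, hn using Nat.le_induction with
    | base => intro _; exact ⟨stg_le _ _ _, hts⟩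
    | succ n hn ih =>
      intro hnp
      obtain ⟨h1, h2⟩ := ih (by omega)
      refine ⟨?_, h2.trans_le (sig_le_succ a y n)⟩
      rw [stg_succ, if_neg]
      · exact h1
      intro hd
      have h3 : dth a y n ≤ b := hd.trans (hsb _ hnp)
      have h4 := cl_of_le h3
      have h5 := y_dth hy ha n h4.symm
      have h6 : (t : ℝ≥0∞) < dth a y n := h2.trans_le (le_hitp _ _)
      have h7 := hmin (cl (dth a y n) b) (by rw [← ENNReal.coe_lt_coe, h4]; exact h6)
        (by rw [← ENNReal.coe_le_coe, h4]; exact h3)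
      rw [h5] at h7
      have : (stg a y n : ℝ) ≤ k + 1 := by exact_mod_cast h1
      linarith
  have hm := (hst (2 * p) (by omega) le_rfl).1
  rw [KK_eq hy ha lam _ _ ((hsb _ le_rfl).trans (by exact_mod_cast hT))]
  have h1 : (stg a y (2 * p) : ℝ) ≤ p := by exact_mod_cast hm.trans hkp
  have h2 : Hs p ≤ Hs (2 * p - stg a y (2 * p)) := Hs_mono (by omega)
  have h3 := Hs_nonneg p
  have h4 : lam * p * Hs p ≤
      lam * (((2 * p : ℕ) : ℝ) - stg a y (2 * p) + 1) * Hs (2 * p - stg a y (2 * p)) := by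
    apply mul_le_mul _ h2 h3
    · apply mul_nonneg hlam
      push_cast
      linarith [Nat.cast_nonneg (α := ℝ) p]
    · apply mul_le_mul_of_nonneg_left _ hlam
      push_cast
      linarith
  simpa using h4

/-! ### Measurability -/

instance mOmega : MeasurableSpace Omega :=
  MeasurableSpace.comap (fun ω : Omega => ω.1) MeasurableSpace.pi

lemma measurable_eval (u : ℝ≥0) : Measurable (fun ω : Omega => ω.1 u) :=
  (measurable_pi_apply u).comp (comap_measurable _)

/-- stopped path -/
def stopAt (t : ℝ≥0) (ω : Omega) : Omega :=
  ⟨fun u => ω.1 (min u t), ω.2.comp (by fun_prop)⟩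

lemma measurable_stopAt (t : ℝ≥0) : @Measurable Omega Omega (F t) mOmega (stopAt t) := by
  apply measurable_comap_iff.2
  apply @measurable_pi_lambda _ _ _ (F t)
  intro u
  have h : F t ≥ MeasurableSpace.comap (fun ω : Omega => ω.1 (min u t)) inferInstance :=
    le_iSup (fun s : {s : ℝ≥0 // s ≤ t} =>
      MeasurableSpace.comap (fun ω : Omega => ω.1 s.1) inferInstance) ⟨min u t, min_le_right _ _⟩
  exact measurable_iff_comap_le.2 h

lemma galmarini {t : ℝ≥0} {B : Set Omega} (hB : MeasurableSet B)
    (h : ∀ ω ω' : Omega, (∀ u ≤ t, ω.1 u = ω'.1 u) → ω ∈ B → ω' ∈ B) :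
    MeasurableSet[F t] B := by
  have : B = stopAt t ⁻¹' B := by
    ext ω
    have hag : ∀ u ≤ t, ω.1 u = (stopAt t ω).1 u := fun u hu => by
      simp [stopAt, min_eq_left hu]
    exact ⟨fun hω => h _ _ hag hω, fun hω => h _ _ (fun u hu => (hag u hu).symm) hω⟩
  rw [this]
  exact measurable_stopAt t hB

lemma toNNReal_le_coe {x : ℝ≥0∞} {t : ℝ≥0} (h : x ≤ t) : x.toNNReal ≤ t := by
  have := ENNReal.toNNReal_mono ENNReal.coe_ne_top h
  rwa [ENNReal.toNNReal_coe] at this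

lemma measurable_hitp {s : Omega → ℝ≥0∞} {z : Omega → ℝ≥0 → ℝ} (hs : Measurable s)
    (hz : ∀ ω, Continuous (z ω)) (hzm : ∀ u, Measurable (fun ω => z ω u)) :
    Measurable (fun ω => hitp (s ω) (z ω)) := by
  have hjoint : Measurable (Function.uncurry (fun (u : ℝ≥0) (ω : Omega) => z ω u)) :=
    measurable_uncurry_of_continuous_of_measurable (fun ω => hz ω) hzm
  apply measurable_of_Iic
  intro c
  rcases eq_or_ne c ⊤ with rfl | hc
  · rw [Set.Iic_top]
    exact MeasurableSet.univ
  lift c to ℝ≥0 using hc with t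
  have : Nonempty (Set.Icc (0 : ℝ≥0) t) := ⟨⟨0, by simp⟩⟩
  let D : ℕ → Set.Icc (0 : ℝ≥0) t := TopologicalSpace.denseSeq _
  have hD : DenseRange D := TopologicalSpace.denseRange_denseSeq _
  have key : (fun ω => hitp (s ω) (z ω)) ⁻¹' Set.Iic (t : ℝ≥0∞) =
      {ω | s ω ≤ t} ∩ ⋂ k : ℕ, ⋃ i : ℕ,
        {ω | -(1 / ((k : ℝ) + 1)) < z ω (max (D i : ℝ≥0) (s ω).toNNReal)} := by
    ext ω
    simp only [Set.mem_preimage, Set.mem_Iic, Set.mem_inter_iff, Set.mem_ofPred_eq, Set.mem_iInter,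
      Set.mem_iUnion]
    rw [hitp_le_iff (hz ω)]
    have hcont : Continuous (fun v : Set.Icc (0 : ℝ≥0) t => z ω (max (v : ℝ≥0) (s ω).toNNReal)) :=
      (hz ω).comp (by fun_prop)
    constructor
    · rintro ⟨u, hu, h1, h2⟩
      refine ⟨h1.trans (by exact_mod_cast hu), fun k => ?_⟩
      have hmax : max u (s ω).toNNReal = u := by
        apply max_eq_left
        exact toNNReal_le_coe h1
      have hop : IsOpen {v : Set.Icc (0 : ℝ≥0) t |
          -(1 / ((k : ℝ) + 1)) < z ω (max (v : ℝ≥0) (s ω).toNNReal)} :=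
        isOpen_lt continuous_const hcont
      obtain ⟨i, hi⟩ := hD.exists_mem_open hop ⟨⟨u, by simp, hu⟩, by
        simp only [Set.mem_ofPred_eq, hmax]
        have : 0 < 1 / ((k : ℝ) + 1) := by positivity
        linarith⟩
      exact ⟨i, hi⟩
    · rintro ⟨h1, h2⟩
      obtain ⟨v, -, hv⟩ := isCompact_univ.exists_isMaxOn (Set.univ_nonempty) hcont.continuousOn
      have h3 : (s ω).toNNReal ≤ t := toNNReal_le_coe h1
      refine ⟨max (v : ℝ≥0) (s ω).toNNReal, max_le v.2.2 h3, ?_, ?_⟩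
      · rw [← ENNReal.coe_toNNReal (ne_top_of_le_ne_top ENNReal.coe_ne_top h1)]
        exact_mod_cast le_max_right _ _
      · by_contra hneg
        push Not at hneg
        obtain ⟨k, hk⟩ := exists_nat_one_div_lt (neg_pos.2 hneg)
        obtain ⟨i, hi⟩ := h2 k
        have := hv (Set.mem_univ (D i))
        simp only [Set.mem_ofPred_eq] at this
        linarith
  rw [key]
  refine (measurableSet_le hs measurable_const).inter ?_
  refine MeasurableSet.iInter fun k => MeasurableSet.iUnion fun i => ?_
  refine measurableSet_lt measurable_const ?_
  exact hjoint.comp ((measurable_const.max hs.ennreal_toNNReal).prodMk measurable_id)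

/-- normalized path -/
noncomputable def Yp (a : ℝ≥0) (sg ε : ℝ) (ω : Omega) (u : ℝ≥0) : ℝ :=
  sg * (ω.1 u - ω.1 a) / ε

lemma Yp_cont (a : ℝ≥0) (sg ε : ℝ) (ω : Omega) : Continuous (Yp a sg ε ω) := by
  have := ω.2
  unfold Yp
  fun_prop

lemma Yp_meas (a : ℝ≥0) (sg ε : ℝ) (u : ℝ≥0) : Measurable (fun ω => Yp a sg ε ω u) := by
  have h1 := measurable_eval u
  have h2 := measurable_eval a
  exact ((h1.sub h2).const_mul sg).div_const ε

lemma Yp_a (a : ℝ≥0) (sg ε : ℝ) (ω : Omega) : Yp a sg ε ω a = 0 := by simp [Yp]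

lemma meas_sig_stg (a : ℝ≥0) (sg ε : ℝ) (n : ℕ) :
    Measurable (fun ω => sig a (Yp a sg ε ω) n) ∧ Measurable (fun ω => stg a (Yp a sg ε ω) n) := by
  induction n with
  | zero => exact ⟨measurable_const, measurable_const⟩
  | succ n ih =>
    have h1 : Measurable (fun ω => sig a (Yp a sg ε ω) (n + 1)) := by
      simp only [sig_succ]
      refine measurable_hitp ih.1 (fun ω => ?_) (fun u => ?_)
      · have := Yp_cont a sg ε ω
        fun_prop
      · exact (Yp_meas a sg ε u).sub_const _
    refine ⟨h1, ?_⟩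
    simp only [stg_succ]
    refine Measurable.ite (measurableSet_le ?_ h1) measurable_const ih.2
    refine measurable_hitp ih.1 (fun ω => ?_) (fun u => ?_)
    · have := Yp_cont a sg ε ω
      fun_prop
    · exact ((measurable_from_nat.comp ih.2).sub_const _).sub (Yp_meas a sg ε u)

lemma meas_rho (a : ℝ≥0) (sg ε : ℝ) (n : ℕ) : Measurable (fun ω => rho a (Yp a sg ε ω) n) := by
  refine Measurable.min ?_ (meas_sig_stg a sg ε (n + 1)).1
  refine measurable_hitp (meas_sig_stg a sg ε n).1 (fun ω => ?_) (fun u => ?_)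
  · have := Yp_cont a sg ε ω
    fun_prop
  · exact ((measurable_from_nat.comp (meas_sig_stg a sg ε n).2).sub_const _).sub (Yp_meas a sg ε u)

lemma Yp_agree {a t : ℝ≥0} {sg ε : ℝ} {ω ω' : Omega} (hat : a ≤ t)
    (h : ∀ u ≤ t, ω.1 u = ω'.1 u) : ∀ u ≤ t, Yp a sg ε ω u = Yp a sg ε ω' u := by
  intro u hu
  unfold Yp
  rw [h u hu, h a hat]

lemma stopping_sig (a : ℝ≥0) (sg ε : ℝ) (n : ℕ) :
    IsStopping (fun ω => sig a (Yp a sg ε ω) n) := by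
  intro t
  refine galmarini (measurableSet_le (meas_sig_stg a sg ε n).1 measurable_const) ?_
  intro ω ω' hag hω
  have hat : a ≤ t := by exact_mod_cast (a_le_sig _ _ _).trans hω
  simp only [Set.mem_ofPred_eq] at hω ⊢
  rwa [(sig_stg_congr (Yp_cont a sg ε ω) (Yp_cont a sg ε ω') (Yp_agree hat hag) n hω).1]

lemma stopping_rho (a : ℝ≥0) (sg ε : ℝ) (n : ℕ) :
    IsStopping (fun ω => rho a (Yp a sg ε ω) n) := by
  intro t
  refine galmarini (measurableSet_le (meas_rho a sg ε n) measurable_const) ?_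
  intro ω ω' hag hω
  have hat : a ≤ t := by exact_mod_cast ((a_le_sig _ _ _).trans (sig_le_rho _ _ _)).trans hω
  exact rho_congr (Yp_cont a sg ε ω) (Yp_cont a sg ε ω') (Yp_agree hat hag) n hω

lemma matime_stg (a : ℝ≥0) (sg ε : ℝ) (n : ℕ) (f : ℕ → ℝ) :
    MeasurableAtTime (fun ω => sig a (Yp a sg ε ω) n) (fun ω => f (stg a (Yp a sg ε ω) n)) := by
  intro B hB t
  refine galmarini (MeasurableSet.inter ?_
    (measurableSet_le (meas_sig_stg a sg ε n).1 measurable_const)) ?_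
  · exact (measurable_from_nat.comp (meas_sig_stg a sg ε n).2) hB
  intro ω ω' hag hω
  have hat : a ≤ t := by exact_mod_cast (a_le_sig _ _ _).trans hω.2
  obtain ⟨h1, h2⟩ :=
    sig_stg_congr (Yp_cont a sg ε ω) (Yp_cont a sg ε ω') (Yp_agree hat hag) n hω.2
  simp only [Set.mem_inter_iff, Set.mem_preimage, Set.mem_ofPred_eq] at hω ⊢
  rw [h1, h2]
  exact hω

lemma matime_zero {τ : Omega → ℝ≥0∞} (hτ : IsStopping τ) : MeasurableAtTime τ (fun _ => 0) := by
  intro B _ t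
  by_cases h : (0 : ℝ) ∈ B
  · have : ((fun _ : Omega => (0 : ℝ)) ⁻¹' B) = Set.univ := by ext; simp [h]
    rw [this, Set.univ_inter]
    exact hτ t
  · have : ((fun _ : Omega => (0 : ℝ)) ⁻¹' B) = ∅ := by ext; simp [h]
    rw [this, Set.empty_inter]
    exact @MeasurableSet.empty _ (F t)

lemma stopping_top : IsStopping (fun _ => ⊤) := by
  intro t
  have : {ω : Omega | (⊤ : ℝ≥0∞) ≤ (t : ℝ≥0∞)} = ∅ := by ext; simp
  rw [this]
  exact @MeasurableSet.empty _ (F t)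

/-! ### Elementary strategies trading on disjoint intervals -/

lemma exists_strategy (N : ℕ) (σ ρ : ℕ → Omega → ℝ≥0∞) (g : ℕ → Omega → ℝ)
    (hσ : ∀ n, IsStopping (σ n)) (hρ : ∀ n, IsStopping (ρ n))
    (h1 : ∀ n ω, σ n ω ≤ ρ n ω) (h2 : ∀ n ω, ρ n ω ≤ σ (n + 1) ω)
    (hb : ∀ n, ∃ C : ℝ, ∀ ω, |g n ω| ≤ C) (hg : ∀ n, MeasurableAtTime (σ n) (g n)) :
    ∃ G : ElemStrategy, ∀ c t ω, elemCapital G c t ω = c + ∑ n ∈ Finset.range N,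
      g n ω * (ω.1 (cl (ρ n ω) t) - ω.1 (cl (σ n ω) t)) := by
  let τ : ℕ → Omega → ℝ≥0∞ := fun i =>
    if i < 2 * N then (if i % 2 = 0 then σ (i / 2) else ρ (i / 2)) else fun _ => ⊤
  let h : ℕ → Omega → ℝ := fun i =>
    if i < 2 * N then (if i % 2 = 0 then g (i / 2) else fun _ => 0) else fun _ => 0
  have hτ : ∀ n, IsStopping (τ n) := by
    intro n
    simp only [τ]
    split_ifs
    · exact hσ _
    · exact hρ _
    · exact stopping_top
  let G : ElemStrategy :=
    { τ := τ
      stopping := hτ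
      mono := by
        intro n ω
        by_cases hn : n + 1 < 2 * N
        · have hn' : n < 2 * N := by omega
          rcases Nat.mod_two_eq_zero_or_one n with hm | hm
          · have e1 : (n + 1) % 2 ≠ 0 := by omega
            have e2 : (n + 1) / 2 = n / 2 := by omega
            simp only [τ, if_pos hn, if_pos hn', if_pos hm, if_neg e1, e2]
            exact h1 _ _
          · have e1 : (n + 1) % 2 = 0 := by omega
            have e2 : (n + 1) / 2 = n / 2 + 1 := by omega
            have e3 : n % 2 ≠ 0 := by omega
            simp only [τ, if_pos hn, if_pos hn', if_pos e1, if_neg e3, e2]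
            exact h2 _ _
        · simp only [τ, if_neg hn]
          exact le_top
      tendsto_top := by
        intro ω
        refine tendsto_const_nhds.congr' ?_
        filter_upwards [eventually_ge_atTop (2 * N)] with i hi
        simp [τ, not_lt.2 hi]
      h := h
      h_bdd := by
        intro n
        simp only [h]
        split_ifs
        · exact hb _
        · exact ⟨0, by simp⟩
        · exact ⟨0, by simp⟩
      h_meas := by
        intro n
        by_cases hn : n < 2 * N
        · by_cases hm : n % 2 = 0
          · simp only [τ, h, if_pos hn, if_pos hm]
            exact hg _
          · simp only [h, if_pos hn, if_neg hm]
            exact matime_zero (hτ n)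
        · simp only [h, if_neg hn]
          exact matime_zero (hτ n) }
  refine ⟨G, fun c t ω => ?_⟩
  unfold elemCapital
  congr 1
  rw [tsum_eq_sum (s := Finset.range (2 * N))]
  · have : ∀ M ≤ N, ∑ n ∈ Finset.range (2 * M),
        G.h n ω * (ω.1 (clip (G.τ (n + 1)) t ω) - ω.1 (clip (G.τ n) t ω)) =
        ∑ n ∈ Finset.range M, g n ω * (ω.1 (cl (ρ n ω) t) - ω.1 (cl (σ n ω) t)) := by
      intro M
      induction M with
      | zero => simp
      | succ M ih =>
        intro hM
        rw [show 2 * (M + 1) = 2 * M + 1 + 1 by ring, Finset.sum_range_succ,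
          Finset.sum_range_succ, Finset.sum_range_succ, ih (by omega)]
        have a1 : 2 * M < 2 * N := by omega
        have a2 : 2 * M + 1 < 2 * N := by omega
        have a3 : (2 * M) % 2 = 0 := by omega
        have a4 : (2 * M + 1) % 2 ≠ 0 := by omega
        have a5 : (2 * M) / 2 = M := by omega
        have a6 : (2 * M + 1) / 2 = M := by omega
        have b1 : G.h (2 * M) = g M := by
          simp only [G, h, if_pos a1, if_pos a3, a5]
        have b2 : G.h (2 * M + 1) = fun _ => 0 := by
          simp only [G, h, if_pos a2, if_neg a4]
        have b3 : G.τ (2 * M) = σ M := by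
          simp only [G, τ, if_pos a1, if_pos a3, a5]
        have b4 : G.τ (2 * M + 1) = ρ M := by
          simp only [G, τ, if_pos a2, if_neg a4, a6]
        rw [b1, b2, b3, b4]
        simp [clip, cl]
    exact this N le_rfl
  · intro n hn
    have hn' : ¬ n < 2 * N := by simpa using hn
    have : G.h n = fun _ => 0 := by simp only [G, h, if_neg hn']
    rw [this]
    simp

/-- The basic events. -/
def Ev (a : ℝ≥0) (sg η : ℝ) : Set Omega :=
  {ω | ∃ t b : ℝ≥0, a ≤ t ∧ t < b ∧ (∀ s, a ≤ s → s ≤ t → sg * ω.1 s ≤ sg * ω.1 t) ∧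
    sg * ω.1 t < sg * ω.1 a + η / 2 ∧ sg * ω.1 a + η ≤ sg * ω.1 b ∧
    ∀ u, t < u → u ≤ b → sg * ω.1 t < sg * ω.1 u}

lemma Ev_strategy (a : ℝ≥0) (sg η : ℝ) (hη : 0 < η) (κ : ℝ) (hκ : 0 < κ) :
    ∃ G : ElemStrategy, (∀ t ω, 0 ≤ elemCapital G κ t ω) ∧
      ∀ ω ∈ Ev a sg η, ∀ᶠ t in atTop, 1 ≤ elemCapital G κ t ω := by
  have hdiv : Tendsto Hs atTop atTop := Real.tendsto_sum_range_one_div_nat_succ_atTop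
  obtain ⟨p, hp, hp0⟩ := ((hdiv.eventually_ge_atTop (2 / κ)).and (eventually_ge_atTop 1)).exists
  have hpr : (0 : ℝ) < p := by exact_mod_cast hp0
  set ε : ℝ := η / (2 * p) with hε
  have hεpos : 0 < ε := by positivity
  set lam : ℝ := κ / (2 * p) with hlam
  have hlampos : 0 < lam := by positivity
  let Y := Yp a sg ε
  let f : ℕ → ℕ → ℝ := fun n m => lam * Hs (n - m + 1) * (sg / ε)
  obtain ⟨G, hG⟩ := exists_strategy (2 * p) (fun n ω => sig a (Y ω) n) (fun n ω => rho a (Y ω) n)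
    (fun n ω => f n (stg a (Y ω) n)) (stopping_sig a sg ε) (stopping_rho a sg ε)
    (fun n ω => sig_le_rho _ _ _) (fun n ω => rho_le_sig _ _ _)
    (by
      intro n
      refine ⟨lam * Hs (n + 1) * |sg / ε|, fun ω => ?_⟩
      simp only [f]
      rw [abs_mul, abs_of_nonneg (mul_nonneg hlampos.le (Hs_nonneg _))]
      have := Hs_mono (show n - stg a (Y ω) n + 1 ≤ n + 1 by omega)
      gcongr)
    (fun n => matime_stg a sg ε n (f n))
  have hK : ∀ t ω, elemCapital G κ t ω = KK a (Y ω) lam (2 * p) (2 * p) t := by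
    intro t ω
    rw [hG]
    unfold KK
    congr 1
    · rw [hlam]; push_cast; field_simp
    · apply Finset.sum_congr rfl
      intro n _
      simp only [f, Y, Yp]
      field_simp
      ring
  refine ⟨G, fun t ω => ?_, ?_⟩
  · rw [hK]
    exact KK_nonneg (Yp_cont a sg ε ω) (Yp_a a sg ε ω) hlampos.le _ _ le_rfl t
  · rintro ω ⟨t, b, hat, htb, hmax, hη1, hη2, hmin⟩
    filter_upwards [eventually_ge_atTop b] with T hT
    rw [hK]
    refine le_trans ?_ (KK_final (Yp_cont a sg ε ω) (Yp_a a sg ε ω) hlampos.le p hat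
      ?_ ?_ ?_ htb ?_ hT)
    · rw [div_le_iff₀ hκ] at hp
      rw [hlam]
      field_simp
      linarith
    · intro s h1 h2
      have := hmax s h1 h2
      unfold Yp
      gcongr ?_ / _
      linarith
    · unfold Yp
      rw [div_lt_iff₀ hεpos, hε]
      have : (p : ℝ) * (η / (2 * p)) = η / 2 := by field_simp
      rw [this]
      linarith
    · unfold Yp
      rw [le_div_iff₀ hεpos, hε]
      have : ((2 * p : ℕ) : ℝ) * (η / (2 * p)) = η := by push_cast; field_simp
      rw [this]
      linarith
    · intro u h1 h2
      have := hmin u h1 h2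
      unfold Yp
      gcongr ?_ / _
      linarith

/-- countable covering principle -/
lemma isNull_of_cover (E : Set Omega) (A : ℕ → Set Omega) (hE : E ⊆ ⋃ i, A i)
    (hA : ∀ i, ∀ κ : ℝ, 0 < κ → ∃ G : ElemStrategy, (∀ t ω, 0 ≤ elemCapital G κ t ω) ∧
      ∀ ω ∈ A i, ∀ᶠ t in atTop, 1 ≤ elemCapital G κ t ω) : IsNull E := by
  unfold IsNull
  rw [← nonpos_iff_eq_zero]
  refine ENNReal.le_of_forall_pos_le_add fun e he _ => ?_
  rw [zero_add]
  have heR : (0 : ℝ) < e := he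
  let c : ℕ → ℝ := fun n => (e : ℝ) / 2 / 2 ^ n
  have hc : ∀ n, 0 < c n := fun n => by positivity
  have hsum : HasSum c e := hasSum_geometric_two' (e : ℝ)
  choose G hG1 hG2 using fun i => hA i (c i) (hc i)
  let S : PosCapital := ⟨G, c, hc, hsum.summable, hG1⟩
  refine (iInf₂_le S ?_).trans ?_
  · intro ω
    by_cases hω : ω ∈ E
    · rw [Set.indicator_of_mem hω]
      obtain ⟨i, hi⟩ := Set.mem_iUnion.1 (hE hω)
      refine le_liminf_of_le (by isBoundedDefault) ?_
      filter_upwards [hG2 i ω hi] with t ht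
      calc (1 : ℝ≥0∞) = ENNReal.ofReal 1 := by simp
        _ ≤ ENNReal.ofReal (elemCapital (G i) (c i) t ω) := ENNReal.ofReal_le_ofReal ht
        _ ≤ S.value t ω := ENNReal.le_tsum (f := fun n =>
            ENNReal.ofReal (elemCapital (G n) (c n) t ω)) i
    · rw [Set.indicator_of_notMem hω]
      exact bot_le
  · change ∑' n, ENNReal.ofReal (c n) ≤ e
    rw [← ENNReal.ofReal_tsum_of_nonneg (fun n => (hc n).le) hsum.summable, hsum.tsum_eq]
    simp

lemma mem_Ev {ω : Omega} {t : ℝ≥0} {sg δ : ℝ} (hδ : 0 < δ)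
    (h1 : ∀ s : ℝ≥0, (t : ℝ) - δ < (s : ℝ) → s < t → sg * ω.1 s ≤ sg * ω.1 t)
    (h2 : ∀ u : ℝ≥0, t < u → (u : ℝ) < (t : ℝ) + δ → sg * ω.1 t < sg * ω.1 u) :
    ∃ (q : ℚ) (r : ℕ), ω ∈ Ev (Real.toNNReal q) sg (1 / ((r : ℝ) + 1)) := by
  have hcont : Continuous (fun u : ℝ => sg * ω.1 (Real.toNNReal u)) := by
    have := ω.2
    fun_prop
  let b : ℝ≥0 := t + Real.toNNReal (δ / 2)
  have hbR : (b : ℝ) = t + δ / 2 := by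
    simp only [b, NNReal.coe_add]
    rw [Real.coe_toNNReal _ (by linarith)]
  have htb : t < b := by
    rw [← NNReal.coe_lt_coe, hbR]; linarith
  have hrise := h2 b htb (by rw [hbR]; linarith)
  obtain ⟨r, hr⟩ := exists_nat_one_div_lt (sub_pos.2 hrise)
  set η : ℝ := 1 / ((r : ℝ) + 1) with hη
  have hηpos : 0 < η := by positivity
  have hopen : IsOpen {u : ℝ | sg * ω.1 t - η / 2 < sg * ω.1 (Real.toNNReal u)} :=
    isOpen_lt continuous_const hcont
  obtain ⟨d, hd, hball⟩ := Metric.isOpen_iff.1 hopen (t : ℝ) (by simp; linarith)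
  obtain ⟨q, hq1, hq2⟩ := exists_rat_btwn (show (t : ℝ) - min d δ < t by
    have := lt_min hd hδ
    linarith)
  have hm1 := min_le_left d δ
  have hm2 := min_le_right d δ
  have hqb : sg * ω.1 t - η / 2 < sg * ω.1 (Real.toNNReal q) := by
    apply hball
    rw [Metric.mem_ball, Real.dist_eq, abs_lt]
    constructor <;> linarith
  have hqt : Real.toNNReal q ≤ t := Real.toNNReal_le_iff_le_coe.2 hq2.le
  have hmax : ∀ s, Real.toNNReal q ≤ s → s ≤ t → sg * ω.1 s ≤ sg * ω.1 t := by
    intro s hs hst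
    rcases hst.eq_or_lt with h | h
    · rw [h]
    · refine h1 s ?_ h
      have := Real.toNNReal_le_iff_le_coe.1 hs
      linarith
  refine ⟨q, r, t, b, hqt, htb, hmax, by linarith, ?_, ?_⟩
  · have := hmax _ le_rfl hqt
    linarith
  · intro u hu hub
    refine h2 u hu ?_
    have : (u : ℝ) ≤ b := by exact_mod_cast hub
    linarith

/-- almost surely, `ω` has no points of semi-strict increase and no
points of semi-strict decrease. -/
theorem no_semistrict_increase_or_decrease :
    IsNull {ω : Omega | ∃ t : ℝ≥0, SemiStrictIncrease ω t ∨ SemiStrictDecrease ω t} := by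
  obtain ⟨e, he⟩ := exists_surjective_nat (ℚ × ℕ × Bool)
  refine isNull_of_cover _ (fun i => Ev (Real.toNNReal (e i).1) (if (e i).2.2 then 1 else -1)
    (1 / (((e i).2.1 : ℝ) + 1))) ?_ ?_
  · rintro ω ⟨t, ⟨δ, hδ, h1, h2⟩ | ⟨δ, hδ, h1, h2⟩⟩
    · obtain ⟨q, r, h⟩ := mem_Ev (ω := ω) (t := t) (sg := 1) hδ (by simpa using h1)
        (by simpa using h2)
      obtain ⟨i, hi⟩ := he (q, r, true)
      refine Set.mem_iUnion.2 ⟨i, ?_⟩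
      rw [hi]
      simpa using h
    · obtain ⟨q, r, h⟩ := mem_Ev (ω := ω) (t := t) (sg := -1) hδ (by simpa using h1)
        (by simpa using h2)
      obtain ⟨i, hi⟩ := he (q, r, false)
      refine Set.mem_iUnion.2 ⟨i, ?_⟩
      rw [hi]
      simpa using h
  · intro i κ hκ
    exact Ev_strategy _ _ _ (by positivity) κ hκ

end GTP
end

section
/- Almost surely, ω is monotone in no open interval unless it is constant in that interval; that is, the set of ω ∈ Ω for which there exists an open interval I ⊆ [0,∞) on which ω is monotone (increasing or decreasing in the wide sense) but not constant is null. -/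
open Filter Topology MeasureTheory
open scoped ENNReal NNReal

namespace GTP

/-- The signed distance to the boundary of the corridor. -/
noncomputable def gap (σ δ c : ℝ) (a : ℝ≥0) (ω : Omega) (s : ℝ≥0) : ℝ :=
  min (δ - σ * (ω.1 s - ω.1 a)) (σ * (ω.1 s - ω.1 a) + c * δ)

lemma gap_cont (σ δ c : ℝ) (a : ℝ≥0) (ω : Omega) : Continuous (gap σ δ c a ω) := by
  have := ω.2
  unfold gap
  fun_prop

/-- Exit time from the corridor after time `a`. -/
noncomputable def exitT (σ δ c : ℝ) (a : ℝ≥0) (ω : Omega) : ℝ≥0∞ :=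
  ⨅ (s : ℝ≥0) (_ : a ≤ s ∧ gap σ δ c a ω s ≤ 0), (s : ℝ≥0∞)

lemma exitT_le {σ δ c : ℝ} {a s : ℝ≥0} {ω : Omega} (h1 : a ≤ s) (h2 : gap σ δ c a ω s ≤ 0) :
    exitT σ δ c a ω ≤ s := iInf₂_le s ⟨h1, h2⟩

lemma le_exitT (σ δ c : ℝ) (a : ℝ≥0) (ω : Omega) : (a : ℝ≥0∞) ≤ exitT σ δ c a ω :=
  le_iInf₂ fun s hs => by exact_mod_cast hs.1

lemma exitT_attained {σ δ c : ℝ} {a t : ℝ≥0} {ω : Omega} (h : exitT σ δ c a ω ≤ t) :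
    ∃ m : ℝ≥0, exitT σ δ c a ω = m ∧ a ≤ m ∧ m ≤ t ∧ gap σ δ c a ω m ≤ 0 := by
  set S : Set ℝ≥0 := {s | a ≤ s ∧ gap σ δ c a ω s ≤ 0} with hS
  have hne : S.Nonempty := by
    by_contra hemp
    rw [Set.not_nonempty_iff_eq_empty] at hemp
    have : exitT σ δ c a ω = ⊤ := by
      unfold exitT
      simp only [iInf_eq_top]
      intro s hs
      have : s ∈ S := hs
      rw [hemp] at this
      exact this.elim
    rw [this] at h
    exact absurd h (by simp)
  have hcl : IsClosed S :=
    (isClosed_le continuous_const continuous_id).inter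
      (isClosed_le (gap_cont σ δ c a ω) continuous_const)
  have hm : sInf S ∈ S := hcl.csInf_mem hne (OrderBot.bddBelow S)
  have he : exitT σ δ c a ω = (sInf S : ℝ≥0) := by
    apply le_antisymm (exitT_le hm.1 hm.2)
    refine le_iInf₂ fun s hs => ?_
    have : sInf S ≤ s := csInf_le (OrderBot.bddBelow S) hs
    exact_mod_cast this
  refine ⟨sInf S, he, hm.1, ?_, hm.2⟩
  rw [he] at h
  exact_mod_cast h

lemma eval_meas {s t : ℝ≥0} (h : s ≤ t) : Measurable[F t] (fun ω : Omega => ω.1 s) := by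
  have h1 : MeasurableSpace.comap (fun ω : Omega => ω.1 s) inferInstance ≤ F t :=
    le_iSup (fun s : {s : ℝ≥0 // s ≤ t} =>
      MeasurableSpace.comap (fun ω : Omega => ω.1 s.1) inferInstance) ⟨s, h⟩
  exact fun B hB => h1 _ ⟨B, hB, rfl⟩

lemma gap_meas (σ δ c : ℝ) {a s t : ℝ≥0} (ha : a ≤ t) (h : s ≤ t) :
    Measurable[F t] (fun ω : Omega => gap σ δ c a ω s) := by
  letI := F t
  have h1 := eval_meas ha
  have h2 := eval_meas h
  unfold gap
  have h3 : Measurable (fun ω : Omega => σ * (ω.1 s - ω.1 a)) := (h2.sub h1).const_mul σ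
  exact (h3.const_sub δ).min (h3.add_const _)

lemma exitT_stopping (σ δ c : ℝ) (a : ℝ≥0) : IsStopping (exitT σ δ c a) := by
  intro t
  by_cases hat : a ≤ t
  · set q : ℕ → ℝ≥0 := fun k => max a (min (TopologicalSpace.denseSeq ℝ≥0 k) t) with hq
    have hset : {ω : Omega | exitT σ δ c a ω ≤ (t : ℝ≥0∞)} =
        ⋂ n : ℕ, ⋃ k : ℕ, {ω : Omega | gap σ δ c a ω (q k) < 1 / ((n : ℝ) + 1)} := by
      ext ω
      simp only [Set.mem_setOf_eq, Set.mem_iInter, Set.mem_iUnion]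
      constructor
      · intro h n
        obtain ⟨m, -, h1, h2, h3⟩ := exitT_attained h
        have hc : Continuous fun s : ℝ≥0 => gap σ δ c a ω (max a (min s t)) :=
          (gap_cont σ δ c a ω).comp (by fun_prop)
        have ho : IsOpen {s : ℝ≥0 | gap σ δ c a ω (max a (min s t)) < 1 / ((n : ℝ) + 1)} :=
          isOpen_lt hc continuous_const
        obtain ⟨x, hx, ⟨k, rfl⟩⟩ := (TopologicalSpace.denseRange_denseSeq ℝ≥0).inter_open_nonempty
          _ ho ⟨m, by
            simp only [Set.mem_setOf_eq]
            rw [min_eq_left h2, max_eq_right h1]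
            exact h3.trans_lt (by positivity)⟩
        exact ⟨k, hx⟩
      · intro h
        obtain ⟨m, hm, hmin⟩ := isCompact_Icc.exists_isMinOn (Set.nonempty_Icc.2 hat)
          (gap_cont σ δ c a ω).continuousOn
        refine (exitT_le hm.1 ?_).trans (by exact_mod_cast hm.2)
        by_contra! hpos
        obtain ⟨n, hn⟩ := exists_nat_one_div_lt hpos
        obtain ⟨k, hk⟩ := h n
        have : gap σ δ c a ω m ≤ gap σ δ c a ω (q k) :=
          hmin ⟨le_max_left _ _, max_le hat (min_le_right _ _)⟩
        linarith
    rw [hset]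
    refine MeasurableSet.iInter fun n => MeasurableSet.iUnion fun k => ?_
    exact (gap_meas σ δ c hat (max_le hat (min_le_right _ _))) measurableSet_Iio
  · have : {ω : Omega | exitT σ δ c a ω ≤ (t : ℝ≥0∞)} = ∅ := by
      ext ω
      simp only [Set.mem_setOf_eq, Set.mem_empty_iff_false, iff_false]
      intro h
      exact hat (by exact_mod_cast (le_exitT σ δ c a ω).trans h)
    rw [this]
    exact @MeasurableSet.empty _ (F t)

lemma const_stopping (x : ℝ≥0∞) : IsStopping (fun _ => x) := fun _ => MeasurableSet.const _

lemma const_measAt {τ : Omega → ℝ≥0∞} (hτ : IsStopping τ) (x : ℝ) :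
    MeasurableAtTime τ (fun _ => x) := by
  intro B _ t
  exact MeasurableSet.inter (MeasurableSet.const (x ∈ B)) (hτ t)

/-- The stopping times of the strategy. -/
noncomputable def times (σ δ c : ℝ) (a : ℝ≥0) : ℕ → Omega → ℝ≥0∞
  | 0 => fun _ => a
  | 1 => exitT σ δ c a
  | _ + 2 => fun _ => ⊤

lemma times_stopping (σ δ c : ℝ) (a : ℝ≥0) : ∀ n, IsStopping (times σ δ c a n)
  | 0 => const_stopping _
  | 1 => exitT_stopping _ _ _ _
  | _ + 2 => const_stopping _

/-- The positions of the strategy. -/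
noncomputable def pos (σ δ : ℝ) : ℕ → ℝ
  | 0 => σ / δ
  | _ + 1 => 0

/-- Buy at `a`, sell at exit. -/
noncomputable def strat (σ δ c : ℝ) (a : ℝ≥0) : ElemStrategy where
  τ := times σ δ c a
  stopping := times_stopping σ δ c a
  mono := by
    intro n ω
    match n with
    | 0 => exact le_exitT _ _ _ _ _
    | _ + 1 => exact le_top
  tendsto_top := by
    intro ω
    refine tendsto_const_nhds.congr' ?_
    filter_upwards [eventually_ge_atTop 2] with n hn
    obtain ⟨k, rfl⟩ := Nat.exists_eq_add_of_le' hn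
    rfl
  h n _ := pos σ δ n
  h_bdd n := ⟨|pos σ δ n|, fun _ => le_rfl⟩
  h_meas n := const_measAt (times_stopping σ δ c a n) _

lemma capital_eq (σ δ c : ℝ) (a t : ℝ≥0) (ω : Omega) :
    elemCapital (strat σ δ c a) c t ω =
      c + σ / δ * (ω.1 (clip (exitT σ δ c a) t ω) - ω.1 (min a t)) := by
  unfold elemCapital
  rw [tsum_eq_single 0]
  · have h : clip ((strat σ δ c a).τ 0) t ω = min a t := by
      change (min (a : ℝ≥0∞) (t : ℝ≥0∞)).toNNReal = min a t
      rw [← ENNReal.coe_min, ENNReal.toNNReal_coe]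
    rw [h]
    rfl
  · intro n hn
    obtain ⟨k, rfl⟩ := Nat.exists_eq_succ_of_ne_zero hn
    change (0 : ℝ) * _ = 0
    simp

lemma coe_clip (τ : Omega → ℝ≥0∞) (t : ℝ≥0) (ω : Omega) :
    (clip τ t ω : ℝ≥0∞) = min (τ ω) t := by
  unfold clip
  rw [ENNReal.coe_toNNReal]
  exact ne_of_lt ((min_le_right _ _).trans_lt ENNReal.coe_lt_top)

lemma capital_nonneg {σ δ c : ℝ} (hδ : 0 < δ) (hc : 0 < c) (a t : ℝ≥0) (ω : Omega) :
    0 ≤ elemCapital (strat σ δ c a) c t ω := by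
  rw [capital_eq]
  set r := clip (exitT σ δ c a) t ω with hr
  have hrc : (r : ℝ≥0∞) = min (exitT σ δ c a ω) t := coe_clip _ _ _
  rcases le_total t a with hta | hat
  · have : r = t := by
      have : (r : ℝ≥0∞) = t := by
        rw [hrc, min_eq_right]
        exact le_trans (by exact_mod_cast hta) (le_exitT σ δ c a ω)
      exact_mod_cast this
    rw [this, min_eq_right hta]
    simp [hc.le]
  · rw [min_eq_left hat]
    have har : a ≤ r := by
      have : (a : ℝ≥0∞) ≤ r := by
        rw [hrc]
        exact le_min (le_exitT σ δ c a ω) (by exact_mod_cast hat)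
      exact_mod_cast this
    have hga : 0 < gap σ δ c a ω a := by
      unfold gap
      simp only [sub_self, mul_zero, sub_zero, zero_add]
      exact lt_min hδ (mul_pos hc hδ)
    have hgr : 0 ≤ gap σ δ c a ω r := by
      by_contra! hneg
      obtain ⟨s, hs, hs0⟩ := intermediate_value_Icc' har (gap_cont σ δ c a ω).continuousOn
        ⟨hneg.le, hga.le⟩
      have h1 : (r : ℝ≥0∞) ≤ s := by
        rw [hrc]
        exact (min_le_left _ _).trans (exitT_le hs.1 hs0.le)
      have h2 : r = s := le_antisymm (by exact_mod_cast h1) hs.2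
      rw [h2] at hneg
      linarith
    have h3 : 0 ≤ σ * (ω.1 r - ω.1 a) + c * δ := hgr.trans (min_le_right _ _)
    have : c + σ / δ * (ω.1 r - ω.1 a) = (σ * (ω.1 r - ω.1 a) + c * δ) / δ := by
      field_simp
      ring
    rw [this]
    positivity

lemma capital_win {σ δ c : ℝ} (hδ : 0 < δ) (hc : 0 < c) {a u t : ℝ≥0} {ω : Omega}
    (hau : a ≤ u) (hut : u ≤ t) (hmono : ∀ s, a ≤ s → s ≤ u → 0 ≤ σ * (ω.1 s - ω.1 a))
    (hwin : δ ≤ σ * (ω.1 u - ω.1 a)) :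
    1 ≤ elemCapital (strat σ δ c a) c t ω := by
  rw [capital_eq, min_eq_left (hau.trans hut)]
  have h0 : gap σ δ c a ω u ≤ 0 := (min_le_left _ _).trans (by linarith)
  obtain ⟨m, hm, ham, hmu, hgm⟩ := exitT_attained (exitT_le hau h0)
  have hr : clip (exitT σ δ c a) t ω = m := by
    have : ((clip (exitT σ δ c a) t ω : ℝ≥0) : ℝ≥0∞) = m := by
      rw [coe_clip, hm, min_eq_left]
      exact_mod_cast hmu.trans hut
    exact_mod_cast this
  rw [hr]
  have hx := hmono m ham hmu
  have hx2 : δ ≤ σ * (ω.1 m - ω.1 a) := by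
    have hcd := mul_pos hc hδ
    unfold gap at hgm
    rcases min_le_iff.1 hgm with h | h <;> linarith
  have : σ / δ * (ω.1 m - ω.1 a) = (σ * (ω.1 m - ω.1 a)) / δ := by ring
  rw [this]
  have : 1 ≤ (σ * (ω.1 m - ω.1 a)) / δ := (one_le_div hδ).2 hx2
  linarith

/-- Index type of the bets. -/
abbrev Idx : Type := (ℕ × ℕ) × Bool

/-- Sign attached to a Boolean. -/
noncomputable def sgn (b : Bool) : ℝ := if b then 1 else -1

/-- The combined bet with total initial capital `2 * ε`. -/
noncomputable def bets (e : ℕ → Idx) (ε : ℝ) (hε : 0 < ε) : PosCapital where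
  G n := strat (sgn (e n).2) (1 / ((e n).1.2 + 1)) (ε * (1 / 2) ^ n)
    (TopologicalSpace.denseSeq ℝ≥0 (e n).1.1)
  c n := ε * (1 / 2) ^ n
  c_pos n := by positivity
  c_summable := summable_geometric_two.mul_left ε
  nonneg n t ω := capital_nonneg (by positivity) (by positivity) _ _ _

lemma bets_init (e : ℕ → Idx) (ε : ℝ) (hε : 0 < ε) :
    (bets e ε hε).init = ENNReal.ofReal (ε * 2) := by
  unfold PosCapital.init
  rw [← ENNReal.ofReal_tsum_of_nonneg (fun n => ((bets e ε hε).c_pos n).le)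
    (bets e ε hε).c_summable]
  congr 1
  change ∑' n : ℕ, ε * (1 / 2 : ℝ) ^ n = _
  rw [tsum_mul_left, tsum_geometric_two]

lemma exists_win {ω : Omega} {a b s u : ℝ≥0} (b0 : Bool)
    (hm : ∀ x ∈ Set.Ioo a b, ∀ y ∈ Set.Ioo a b, x ≤ y → 0 ≤ sgn b0 * (ω.1 y - ω.1 x))
    (hs : s ∈ Set.Ioo a b) (hu : u ∈ Set.Ioo a b) (hsu : s ≤ u) (hne : ω.1 s ≠ ω.1 u) :
    ∃ i : Idx, ∃ v : ℝ≥0, ∀ c : ℝ, 0 < c → ∀ t, v ≤ t →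
      1 ≤ elemCapital (strat (sgn i.2) (1 / (i.1.2 + 1)) c
        (TopologicalSpace.denseSeq ℝ≥0 i.1.1)) c t ω := by
  obtain ⟨x, hx, ⟨k, rfl⟩⟩ := (TopologicalSpace.denseRange_denseSeq ℝ≥0).inter_open_nonempty
    _ (isOpen_Ioo (a := a) (b := s)) (Set.nonempty_Ioo.2 hs.1)
  have hsg : sgn b0 ≠ 0 := by unfold sgn; split_ifs <;> norm_num
  have hpos : 0 < sgn b0 * (ω.1 u - ω.1 s) :=
    lt_of_le_of_ne (hm s hs u hu hsu) (mul_ne_zero hsg (sub_ne_zero.2 hne.symm)).symm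
  obtain ⟨m, hmm⟩ := exists_nat_one_div_lt hpos
  set d := TopologicalSpace.denseSeq ℝ≥0 k with hd
  have hdI : d ∈ Set.Ioo a b := ⟨hx.1, hx.2.trans hs.2⟩
  refine ⟨((k, m), b0), u, fun c hc t ht => ?_⟩
  refine capital_win (by positivity) hc (hx.2.le.trans hsu) ht ?_ ?_
  · intro y h1 h2
    exact hm d hdI y ⟨hx.1.trans_le h1, h2.trans_lt hu.2⟩ h1
  · have h2 := hm d hdI s hs hx.2.le
    have h3 : sgn b0 * (ω.1 u - ω.1 d) =
      sgn b0 * (ω.1 u - ω.1 s) + sgn b0 * (ω.1 s - ω.1 d) := by ring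
    change 1 / ((m : ℝ) + 1) ≤ sgn b0 * (ω.1 u - ω.1 d)
    linarith

/-- almost surely, `ω` is monotone in no open interval unless it
is constant there: the set of `ω` that are monotone but not constant on some
open interval is null. -/
theorem nowhere_monotone_unless_constant :
    IsNull {ω : Omega | ∃ a b : ℝ≥0, a < b ∧
      (MonotoneOn ω.1 (Set.Ioo a b) ∨ AntitoneOn ω.1 (Set.Ioo a b)) ∧
      ∃ s ∈ Set.Ioo a b, ∃ u ∈ Set.Ioo a b, ω.1 s ≠ ω.1 u} := by
  obtain ⟨e, he⟩ := exists_surjective_nat Idx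
  have key : ∀ ε : ℝ, 0 < ε → UpProb {ω : Omega | ∃ a b : ℝ≥0, a < b ∧
      (MonotoneOn ω.1 (Set.Ioo a b) ∨ AntitoneOn ω.1 (Set.Ioo a b)) ∧
      ∃ s ∈ Set.Ioo a b, ∃ u ∈ Set.Ioo a b, ω.1 s ≠ ω.1 u} ≤ ENNReal.ofReal (ε * 2) := by
    intro ε hε
    rw [← bets_init e ε hε]
    refine iInf₂_le (bets e ε hε) fun ω => ?_
    by_cases hω : ω ∈ {ω : Omega | ∃ a b : ℝ≥0, a < b ∧
      (MonotoneOn ω.1 (Set.Ioo a b) ∨ AntitoneOn ω.1 (Set.Ioo a b)) ∧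
      ∃ s ∈ Set.Ioo a b, ∃ u ∈ Set.Ioo a b, ω.1 s ≠ ω.1 u}
    · rw [Set.indicator_of_mem hω]
      obtain ⟨a, b, -, hmon, s, hs, u, hu, hne⟩ := hω
      obtain ⟨b0, hm⟩ : ∃ b0 : Bool, ∀ x ∈ Set.Ioo a b, ∀ y ∈ Set.Ioo a b, x ≤ y →
          0 ≤ sgn b0 * (ω.1 y - ω.1 x) := by
        rcases hmon with h | h
        · refine ⟨true, fun x hx y hy hxy => ?_⟩
          have := h hx hy hxy
          simp only [sgn, if_true]
          linarith
        · refine ⟨false, fun x hx y hy hxy => ?_⟩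
          have := h hx hy hxy
          simp only [sgn, Bool.false_eq_true, if_false]
          linarith
      obtain ⟨i, v, hv⟩ : ∃ i : Idx, ∃ v : ℝ≥0, ∀ c : ℝ, 0 < c → ∀ t, v ≤ t →
          1 ≤ elemCapital (strat (sgn i.2) (1 / (i.1.2 + 1)) c
            (TopologicalSpace.denseSeq ℝ≥0 i.1.1)) c t ω := by
        rcases le_total s u with h | h
        · exact exists_win b0 hm hs hu h hne
        · exact exists_win b0 hm hu hs h hne.symm
      obtain ⟨n, rfl⟩ := he i
      refine le_liminf_of_le (by isBoundedDefault) ?_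
      filter_upwards [eventually_ge_atTop v] with t ht
      have h1 := hv (ε * (1 / 2) ^ n) (by positivity) t ht
      have h2 : (1 : ℝ≥0∞) ≤
          ENNReal.ofReal (elemCapital ((bets e ε hε).G n) ((bets e ε hε).c n) t ω) :=
        ENNReal.one_le_ofReal.2 h1
      exact h2.trans (ENNReal.le_tsum n)
    · rw [Set.indicator_of_notMem hω]
      exact zero_le
  refine le_antisymm (ENNReal.le_of_forall_pos_le_add fun ε hε _ => ?_) zero_le
  refine (key (ε / 2) (by positivity)).trans ?_
  rw [zero_add, div_mul_cancel₀ _ two_ne_zero, ENNReal.ofReal_coe_nnreal]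

end GTP
end
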